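/- Uniform convergence of marginals of hard-sphere conditioned tensor products: let d ≥ 2, ℓ > 0, and for each N let ε = ε(N) = (ℓ N)^{−1/(d−1)}. Let f_{0,N} : ℝ^d × ℝ^d → [0, ∞) be measurable with ∫ f_{0,N} = 1 and satisfying a uniform Gaussian bound (for some C₀, β₀ > 0, f_{0,N}(x,v) ≤ C₀ e^{−(β₀/2)(|x|²+|v|²)} for all N and all (x,v)). Define 𝒵_N = ∫_{(ℝ^{2d})^N} f_{0,N}^{⊗N} 1_{𝒟_N}, assume 𝒵_N > 0, set f_N(Z_N) = 𝒵_N^{−1} f_{0,N}^{⊗N}(Z_N) 1_{Z_N ∈ 𝒟_N}, and for 1 ≤ s ≤ N define the marginal f_N^{(s)}(Z_s) = ∫_{(ℝ^{2d})^{N−s}} f_N(Z_N) dz_{s+1} … dz_N. Then for every fixed s ≥ 1, limsup_{N→∞} sup_{Z_s ∈ 𝒟_s} | f_N^{(s)}(Z_s) − f_{0,N}^{⊗s}(Z_s) | = 0. -/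

import Mathlib

open MeasureTheory

noncomputable section

/-- A single-particle phase point `(x, v) ∈ ℝ^d × ℝ^d`. -/
abbrev PhasePoint (d : ℕ) := EuclideanSpace ℝ (Fin d) × EuclideanSpace ℝ (Fin d)

/-- The hard-sphere phase space `𝒟_s` of `s` spheres of diameter `ε`. -/
def hardSpherePhaseSpace (d s : ℕ) (ε : ℝ) : Set (Fin s → PhasePoint d) :=
  {Z | ∀ i j : Fin s, i < j → ε < ‖(Z i).1 - (Z j).1‖}

/-- The `s`-fold tensor power `g^{⊗s}(Z_s) = ∏ᵢ g(zᵢ)`. -/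
def tensorPow (d s : ℕ) (g : PhasePoint d → ℝ) (Z : Fin s → PhasePoint d) : ℝ :=
  ∏ i, g (Z i)

/-- The normalization factor `𝒵_N = ∫ g^{⊗N} 1_{𝒟_N}`. -/
def normConst (d N : ℕ) (ε : ℝ) (g : PhasePoint d → ℝ) : ℝ :=
  ∫ Z : Fin N → PhasePoint d,
    Set.indicator (hardSpherePhaseSpace d N ε) (tensorPow d N g) Z

/-- The `s`-particle marginal of a density `f_N` on `(ℝ^{2d})^N`: integrate out the
last `N − s` particles. -/
def marginal (d N s : ℕ) (fN : (Fin N → PhasePoint d) → ℝ)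
    (Zs : Fin s → PhasePoint d) : ℝ :=
  ∫ Y : Fin (N - s) → PhasePoint d,
    fN (fun k => if h : (k : ℕ) < s then Zs ⟨k, h⟩
      else Y ⟨(k : ℕ) - s, by have := k.isLt; omega⟩)

/-- The probability measure with density `g`. -/
def dens (d : ℕ) (g : PhasePoint d → ℝ) : Measure (PhasePoint d) :=
  volume.withDensity (fun p => ENNReal.ofReal (g p))

lemma dens_prob {d : ℕ} {g : PhasePoint d → ℝ} (hp : ∀ p, 0 ≤ g p)
    (hi : ∫ p, g p = 1) : IsProbabilityMeasure (dens d g) := by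
  have hI : Integrable g := by
    by_contra h
    rw [integral_undef h] at hi
    exact zero_ne_one hi
  constructor
  rw [dens, withDensity_apply _ MeasurableSet.univ, Measure.restrict_univ,
    ← ofReal_integral_eq_lintegral_ofReal hI (Filter.Eventually.of_forall hp), hi,
    ENNReal.ofReal_one]

lemma pi_dens {d : ℕ} {g : PhasePoint d → ℝ} (hp : ∀ p, 0 ≤ g p)
    (hi : ∫ p, g p = 1) (k : ℕ) :
    Measure.pi (fun _ : Fin k => dens d g)
      = volume.withDensity (fun Z => ENNReal.ofReal (tensorPow d k g Z)) := by
  have hI : Integrable g := by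
    by_contra h
    rw [integral_undef h] at hi
    exact zero_ne_one hi
  have := dens_prob hp hi
  refine Measure.pi_eq fun S hS => ?_
  rw [withDensity_apply _ (MeasurableSet.univ_pi hS), ← lintegral_indicator (MeasurableSet.univ_pi hS)]
  have h1 : ∀ Z : Fin k → PhasePoint d, (Set.univ.pi S).indicator
      (fun Z => ENNReal.ofReal (tensorPow d k g Z)) Z
      = ENNReal.ofReal (∏ i, (S i).indicator g (Z i)) := by
    intro Z
    by_cases h : Z ∈ Set.univ.pi S
    · rw [Set.indicator_of_mem h]
      congr 1
      refine Finset.prod_congr rfl fun i _ => ?_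
      rw [Set.indicator_of_mem (h i trivial)]
    · rw [Set.indicator_of_notMem h]
      simp only [Set.mem_pi, Set.mem_univ, true_imp_iff, not_forall] at h
      obtain ⟨i, hi⟩ := h
      rw [Finset.prod_eq_zero (Finset.mem_univ i) (Set.indicator_of_notMem hi g), ENNReal.ofReal_zero]
  simp_rw [h1]
  have hnn : ∀ i p, 0 ≤ (S i).indicator g p := fun i p => Set.indicator_nonneg (fun p _ => hp p) p
  have hint : Integrable (fun Z : Fin k → PhasePoint d => ∏ i, (S i).indicator g (Z i)) volume :=
    Integrable.fintype_prod fun i => hI.indicator (hS i)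
  rw [← ofReal_integral_eq_lintegral_ofReal hint
    (Filter.Eventually.of_forall fun Z => Finset.prod_nonneg fun i _ => hnn i _),
    integral_fintype_prod_volume_eq_prod (fun i => (S i).indicator g),
    ENNReal.ofReal_prod_of_nonneg (fun i _ => integral_nonneg (hnn i))]
  refine Finset.prod_congr rfl fun i _ => ?_
  rw [dens, withDensity_apply _ (hS i), integral_indicator (hS i),
    ofReal_integral_eq_lintegral_ofReal hI.integrableOn (Filter.Eventually.of_forall hp)]

lemma integral_ind {d : ℕ} {g : PhasePoint d → ℝ} (hm : Measurable g) (hp : ∀ p, 0 ≤ g p)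
    (hi : ∫ p, g p = 1) (k : ℕ) {S : Set (Fin k → PhasePoint d)} (hS : MeasurableSet S) :
    ∫ Z, S.indicator (tensorPow d k g) Z
      = (Measure.pi (fun _ : Fin k => dens d g)).real S := by
  have hmt : Measurable (tensorPow d k g) := by
    unfold tensorPow
    fun_prop
  have hnn : ∀ Z, 0 ≤ tensorPow d k g Z := fun Z => Finset.prod_nonneg fun i _ => hp _
  rw [pi_dens hp hi, measureReal_def, withDensity_apply _ hS, integral_indicator hS,
    integral_eq_lintegral_of_nonneg_ae
      (Filter.Eventually.of_forall hnn)
      hmt.aestronglyMeasurable]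

lemma meas_hs (d k : ℕ) (ε : ℝ) : MeasurableSet (hardSpherePhaseSpace d k ε) := by
  unfold hardSpherePhaseSpace
  simp only [Set.ofPred_forall]
  refine MeasurableSet.iInter fun i => MeasurableSet.iInter fun j => MeasurableSet.iInter fun _ => ?_
  exact measurableSet_lt (by fun_prop) (by fun_prop)

/-- removing a particle -/
lemma hs_remove {d k : ℕ} {ε : ℝ} {Z : Fin (k+1) → PhasePoint d} (j : Fin (k+1))
    (h : Z ∈ hardSpherePhaseSpace d (k+1) ε) :
    (fun i => Z (j.succAbove i)) ∈ hardSpherePhaseSpace d k ε :=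
  fun a b hab => h _ _ (Fin.strictMono_succAbove j hab)

section steps
variable {d : ℕ} (μ : Measure (PhasePoint d)) [IsProbabilityMeasure μ] (ε : ℝ)

lemma step_ball {A : ENNReal} (hA : ∀ x, μ {p | ‖p.1 - x‖ ≤ ε} ≤ A) (k : ℕ) (j : Fin (k+1))
    (x : EuclideanSpace ℝ (Fin d)) :
    Measure.pi (fun _ : Fin (k+1) => μ)
      (hardSpherePhaseSpace d (k+1) ε ∩ {Z | ‖(Z j).1 - x‖ ≤ ε})
      ≤ A * Measure.pi (fun _ : Fin k => μ) (hardSpherePhaseSpace d k ε) := by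
  have hmp := measurePreserving_piFinSuccAbove (fun _ : Fin (k+1) => μ) j
  calc _ ≤ Measure.pi (fun _ : Fin (k+1) => μ)
        ((MeasurableEquiv.piFinSuccAbove (fun _ => PhasePoint d) j) ⁻¹'
          ({p | ‖p.1 - x‖ ≤ ε} ×ˢ hardSpherePhaseSpace d k ε)) := by
        refine measure_mono fun Z hZ => ?_
        exact ⟨hZ.2, hs_remove j hZ.1⟩
    _ = _ := hmp.measure_preimage_equiv _
    _ ≤ _ := by
        rw [Measure.prod_prod]
        gcongr
        exact hA x

lemma step_mono (k : ℕ) :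
    Measure.pi (fun _ : Fin (k+1) => μ) (hardSpherePhaseSpace d (k+1) ε)
      ≤ Measure.pi (fun _ : Fin k => μ) (hardSpherePhaseSpace d k ε) := by
  have hmp := measurePreserving_piFinSuccAbove (fun _ : Fin (k+1) => μ) 0
  calc _ ≤ Measure.pi (fun _ : Fin (k+1) => μ)
        ((MeasurableEquiv.piFinSuccAbove (fun _ => PhasePoint d) 0) ⁻¹'
          (Set.univ ×ˢ hardSpherePhaseSpace d k ε)) := by
        refine measure_mono fun Z hZ => ?_
        exact ⟨trivial, hs_remove 0 hZ⟩
    _ = _ := hmp.measure_preimage_equiv _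
    _ = _ := by
        rw [Measure.prod_prod, measure_univ, one_mul]

lemma step_lower {A : ENNReal} (hA : ∀ x, μ {p | ‖p.1 - x‖ ≤ ε} ≤ A) (k : ℕ) :
    Measure.pi (fun _ : Fin k => μ) (hardSpherePhaseSpace d k ε)
      ≤ Measure.pi (fun _ : Fin (k+1) => μ) (hardSpherePhaseSpace d (k+1) ε)
        + k * (A * Measure.pi (fun _ : Fin k => μ) (hardSpherePhaseSpace d k ε)) := by
  set P := Measure.pi (fun _ : Fin k => μ)
  have hmp := measurePreserving_piFinSuccAbove (fun _ : Fin (k+1) => μ) 0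
  set e := MeasurableEquiv.piFinSuccAbove (fun _ : Fin (k+1) => PhasePoint d) 0
  let B : Fin k → Set (PhasePoint d × (Fin k → PhasePoint d)) := fun j =>
    {q | q.2 ∈ hardSpherePhaseSpace d k ε ∧ ‖q.1.1 - (q.2 j).1‖ ≤ ε}
  have hBm : ∀ j, MeasurableSet (B j) := by
    intro j
    have h2 : MeasurableSet {q : PhasePoint d × (Fin k → PhasePoint d) |
        ‖q.1.1 - (q.2 j).1‖ ≤ ε} := measurableSet_le (by fun_prop) (by fun_prop)
    exact (measurable_snd (meas_hs d k ε)).inter h2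
  have hB : ∀ j, μ.prod P (B j) ≤ A * P (hardSpherePhaseSpace d k ε) := by
    intro j
    rw [Measure.prod_apply_symm (hBm j)]
    calc _ ≤ ∫⁻ Y, (hardSpherePhaseSpace d k ε).indicator (fun _ => A) Y ∂P := by
          refine lintegral_mono fun Y => ?_
          by_cases hY : Y ∈ hardSpherePhaseSpace d k ε
          · rw [Set.indicator_of_mem hY]
            exact (measure_mono fun p hp => hp.2).trans (hA (Y j).1)
          · rw [Set.indicator_of_notMem hY]
            refine le_of_eq (measure_mono_null (t := ∅) (fun p hp => hY hp.1) measure_empty)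
      _ = _ := by rw [lintegral_indicator_const (meas_hs d k ε)]
  calc P (hardSpherePhaseSpace d k ε) = μ.prod P (Set.univ ×ˢ hardSpherePhaseSpace d k ε) := by
        rw [Measure.prod_prod, measure_univ, one_mul]
    _ ≤ μ.prod P (e.symm ⁻¹' (hardSpherePhaseSpace d (k+1) ε) ∪ ⋃ j, B j) := by
        refine measure_mono ?_
        rintro ⟨y, Y⟩ ⟨-, hY⟩
        by_cases h : ∃ j, ‖y.1 - (Y j).1‖ ≤ ε
        · obtain ⟨j, hj⟩ := h
          exact Or.inr (Set.mem_iUnion.2 ⟨j, hY, hj⟩)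
        · left
          push Not at h
          have he : e.symm (y, Y) = Fin.cons y Y := by
            simp [e, MeasurableEquiv.piFinSuccAbove_symm_apply, Fin.insertNthEquiv]
          rw [Set.mem_preimage, he]
          intro a b hab
          induction b using Fin.cases with
          | zero => exact absurd hab (Fin.not_lt_zero a)
          | succ b =>
            induction a using Fin.cases with
            | zero => simpa using h b
            | succ a => simpa using hY a b (Fin.succ_lt_succ_iff.1 hab)
    _ ≤ _ := measure_union_le _ _
    _ ≤ _ := by
        gcongr
        · exact le_of_eq (hmp.symm.measure_preimage_equiv _)
        · calc _ ≤ ∑ j, μ.prod P (B j) := by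
                simpa using measure_iUnion_fintype_le (μ.prod P) B
            _ ≤ ∑ j : Fin k, A * P (hardSpherePhaseSpace d k ε) := Finset.sum_le_sum fun j _ => hB j
            _ = _ := by simp

/-- Configurations compatible with `Zs`. -/
def crossSet (s k : ℕ) (Zs : Fin s → PhasePoint d) : Set (Fin k → PhasePoint d) :=
  hardSpherePhaseSpace d k ε ∩ {Y | ∀ i j, ε < ‖(Zs i).1 - (Y j).1‖}

lemma meas_cross (s k : ℕ) (Zs : Fin s → PhasePoint d) : MeasurableSet (crossSet ε s k Zs) := by
  refine (meas_hs d k ε).inter ?_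
  simp only [Set.ofPred_forall]
  refine MeasurableSet.iInter fun i => MeasurableSet.iInter fun j => ?_
  exact measurableSet_lt (by fun_prop) (by fun_prop)

lemma step_cross {A : ENNReal} (hA : ∀ x, μ {p | ‖p.1 - x‖ ≤ ε} ≤ A) (s k : ℕ)
    (Zs : Fin s → PhasePoint d) :
    Measure.pi (fun _ : Fin (k+1) => μ) (hardSpherePhaseSpace d (k+1) ε)
      ≤ Measure.pi (fun _ : Fin (k+1) => μ) (crossSet ε s (k+1) Zs)
        + s * ((k+1 : ℕ) * (A * Measure.pi (fun _ : Fin k => μ) (hardSpherePhaseSpace d k ε))) := by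
  set P := Measure.pi (fun _ : Fin (k+1) => μ)
  calc P (hardSpherePhaseSpace d (k+1) ε)
      ≤ P (crossSet ε s (k+1) Zs ∪ ⋃ i : Fin s, ⋃ j : Fin (k+1),
          (hardSpherePhaseSpace d (k+1) ε ∩ {Z | ‖(Z j).1 - (Zs i).1‖ ≤ ε})) := by
        refine measure_mono fun Y hY => ?_
        by_cases h : ∃ i j, ‖(Zs i).1 - (Y j).1‖ ≤ ε
        · obtain ⟨i, j, hij⟩ := h
          exact Or.inr (Set.mem_iUnion.2 ⟨i, Set.mem_iUnion.2 ⟨j, hY, by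
            rw [Set.mem_ofPred_eq, norm_sub_rev]; exact hij⟩⟩)
        · push Not at h
          exact Or.inl ⟨hY, h⟩
    _ ≤ _ := measure_union_le _ _
    _ ≤ _ := by
        gcongr
        refine (measure_iUnion_fintype_le _ _).trans ?_
        refine (Finset.sum_le_sum fun i _ => (measure_iUnion_fintype_le _ _).trans
          (Finset.sum_le_sum fun j _ => step_ball μ ε hA k j (Zs i).1)).trans ?_
        simp

end steps

lemma marginal_eq {d : ℕ} {g : PhasePoint d → ℝ} (hm : Measurable g) (hp : ∀ p, 0 ≤ g p)
    (hi : ∫ p, g p = 1) (ε c : ℝ) (N s : ℕ) (hs : s ≤ N) (Zs : Fin s → PhasePoint d)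
    (hZs : Zs ∈ hardSpherePhaseSpace d s ε) :
    marginal d N s (fun Z => c *
        Set.indicator (hardSpherePhaseSpace d N ε) (tensorPow d N g) Z) Zs
      = c * (tensorPow d s g Zs *
        (Measure.pi (fun _ : Fin (N - s) => dens d g)).real (crossSet ε s (N - s) Zs)) := by
  rw [← integral_ind hm hp hi (N - s) (meas_cross ε s (N - s) Zs), marginal, integral_const_mul]
  congr 1
  rw [← integral_const_mul]
  refine integral_congr_ae (Filter.Eventually.of_forall fun Y => ?_)
  beta_reduce
  set W : Fin N → PhasePoint d := fun k => if h : (k : ℕ) < s then Zs ⟨k, h⟩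
      else Y ⟨(k : ℕ) - s, by have := k.isLt; omega⟩ with hW
  let e : Fin s ⊕ Fin (N - s) ≃ Fin N := finSumFinEquiv.trans (finCongr (by omega))
  have he1 : ∀ i : Fin s, ((e (Sum.inl i) : Fin N) : ℕ) = i := fun i => by simp [e]
  have he2 : ∀ i : Fin (N - s), ((e (Sum.inr i) : Fin N) : ℕ) = s + i := fun i => by simp [e]
  have hW1 : ∀ i : Fin s, W (e (Sum.inl i)) = Zs i := fun i => by
    simp only [hW, he1, i.isLt, dif_pos]
  have hW2 : ∀ i : Fin (N - s), W (e (Sum.inr i)) = Y i := fun i => by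
    have : ¬ (s + (i : ℕ) < s) := by omega
    simp only [hW, he2, this, dif_neg, not_false_iff]
    congr 1
    ext
    simp
  have hprod : tensorPow d N g W = tensorPow d s g Zs * tensorPow d (N - s) g Y := by
    unfold tensorPow
    rw [← e.prod_comp, Fintype.prod_sum_type]
    simp only [hW1, hW2]
  have hmem : W ∈ hardSpherePhaseSpace d N ε ↔ Y ∈ crossSet ε s (N - s) Zs := by
    constructor
    · intro h
      refine ⟨fun a b hab => ?_, fun i j => ?_⟩
      · have := h (e (Sum.inr a)) (e (Sum.inr b)) (by
          rw [Fin.lt_def, he2, he2]; have := Fin.lt_def.1 hab; omega)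
        rwa [hW2, hW2] at this
      · have := h (e (Sum.inl i)) (e (Sum.inr j)) (by
          rw [Fin.lt_def, he1, he2]; omega)
        rwa [hW1, hW2] at this
    · rintro ⟨h1, h2⟩ a b hab
      obtain ⟨a, rfl⟩ := e.surjective a
      obtain ⟨b, rfl⟩ := e.surjective b
      rw [Fin.lt_def] at hab
      rcases a with a | a <;> rcases b with b | b
      · rw [hW1, hW1]
        rw [he1, he1] at hab
        exact hZs a b hab
      · rw [hW1, hW2]
        exact h2 a b
      · rw [he2, he1] at hab
        omega
      · rw [hW2, hW2]
        rw [he2, he2] at hab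
        exact h1 a b (by rw [Fin.lt_def]; omega)
  by_cases h : Y ∈ crossSet ε s (N - s) Zs
  · rw [Set.indicator_of_mem h, Set.indicator_of_mem (hmem.2 h), hprod]
  · rw [Set.indicator_of_notMem h, Set.indicator_of_notMem (fun h' => h (hmem.1 h')), mul_zero]

lemma ball_bound {d : ℕ} (C₀ β₀ : ℝ) (hβ₀ : 0 < β₀) (hC₀ : 0 < C₀) :
    ∃ K : ℝ, 0 ≤ K ∧ ∀ g : PhasePoint d → ℝ,
      (∀ p, g p ≤ C₀ * Real.exp (-(β₀ / 2) * (‖p.1‖ ^ 2 + ‖p.2‖ ^ 2))) →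
      ∀ ε : ℝ, 0 ≤ ε → ∀ x, dens d g {p | ‖p.1 - x‖ ≤ ε} ≤ ENNReal.ofReal (K * ε ^ d) := by
  let G : EuclideanSpace ℝ (Fin d) → ℝ := fun v => C₀ * Real.exp (-(β₀ / 2) * ‖v‖ ^ 2)
  have hG : Integrable G := by
    refine Integrable.const_mul ?_ _
    have := (GaussianFourier.integrable_cexp_neg_mul_sq_norm_add
      (show 0 < ((β₀ / 2 : ℝ) : ℂ).re by simpa using hβ₀) 0 (0 : EuclideanSpace ℝ (Fin d))).norm
    refine this.congr (Filter.Eventually.of_forall fun v => ?_)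
    simp only [Complex.norm_exp]
    congr 1
    simp [← Complex.ofReal_pow]
  have hGn : ∀ v, 0 ≤ G v := fun v => by positivity
  let V : ENNReal := volume (Metric.ball (0 : EuclideanSpace ℝ (Fin d)) 1)
  have hV : V ≠ ⊤ := measure_ball_lt_top.ne
  refine ⟨V.toReal * ∫ v, G v, mul_nonneg ENNReal.toReal_nonneg (integral_nonneg hGn), ?_⟩
  intro g hg ε hε x
  have hset : {p : PhasePoint d | ‖p.1 - x‖ ≤ ε} = Metric.closedBall x ε ×ˢ Set.univ := by
    ext p
    simp [dist_eq_norm]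
  rw [hset, dens, withDensity_apply _ (measurableSet_closedBall.prod MeasurableSet.univ)]
  calc _ ≤ ∫⁻ p in Metric.closedBall x ε ×ˢ Set.univ, ENNReal.ofReal (G p.2)
          ∂(volume : Measure (PhasePoint d)) := by
        refine lintegral_mono fun p => ENNReal.ofReal_le_ofReal ((hg p).trans ?_)
        refine mul_le_mul_of_nonneg_left (Real.exp_le_exp.2 ?_) hC₀.le
        nlinarith [mul_nonneg hβ₀.le (sq_nonneg ‖p.1‖)]
    _ = volume (Metric.closedBall x ε) * ∫⁻ v, ENNReal.ofReal (G v) := by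
        rw [Measure.volume_eq_prod, ← Measure.prod_restrict, Measure.restrict_univ,
          lintegral_prod _ (by fun_prop)]
        simp [mul_comm]
    _ = _ := by
        rw [Measure.addHaar_closedBall _ _ hε,
          ← ofReal_integral_eq_lintegral_ofReal hG (Filter.Eventually.of_forall hGn),
          finrank_euclideanSpace_fin]
        change _ * V * _ = _
        rw [← ENNReal.ofReal_toReal hV, ← ENNReal.ofReal_mul (by positivity),
          ← ENNReal.ofReal_mul (by positivity), ENNReal.toReal_ofReal ENNReal.toReal_nonneg]
        congr 1
        ring

lemma lim_scaling (d : ℕ) (hd : 2 ≤ d) (ℓ : ℝ) (hℓ : 0 < ℓ) :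
    Filter.Tendsto (fun N : ℕ => (N : ℝ) * ((ℓ * N) ^ (-(1 : ℝ) / (d - 1))) ^ d)
      Filter.atTop (nhds 0) := by
  have hd' : (0 : ℝ) < d - 1 := by
    have : (2 : ℝ) ≤ d := by exact_mod_cast hd
    linarith
  have h1 : Filter.Tendsto (fun N : ℕ => ℓ⁻¹ * (ℓ * N) ^ (-((1 : ℝ) / (d - 1))))
      Filter.atTop (nhds (ℓ⁻¹ * 0)) :=
    ((tendsto_rpow_neg_atTop (by positivity)).comp
      (tendsto_natCast_atTop_atTop.const_mul_atTop hℓ)).const_mul _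
  rw [mul_zero] at h1
  refine h1.congr' ?_
  filter_upwards [Filter.eventually_gt_atTop 0] with N hN
  have hN' : (0 : ℝ) < ℓ * N := by positivity
  have h2 : (N : ℝ) = ℓ⁻¹ * (ℓ * N) ^ (1 : ℝ) := by
    rw [Real.rpow_one]; field_simp
  rw [← Real.rpow_natCast, ← Real.rpow_mul hN'.le]
  conv_rhs => rw [h2]
  rw [mul_assoc, ← h2, ← Real.rpow_add hN']
  congr 2
  field_simp
  ring

/-- Uniform convergence of marginals of hard-sphere conditioned tensor products in the
Boltzmann-Grad scaling `ε(N) = (ℓ N)^{−1/(d−1)}`: for each fixed `s`,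
`sup_{Z_s ∈ 𝒟_s} |f_N^{(s)}(Z_s) − f_{0,N}^{⊗s}(Z_s)| → 0` as `N → ∞`. -/
theorem marginals_uniform_convergence (d : ℕ) (hd : 2 ≤ d) (ℓ : ℝ) (hℓ : 0 < ℓ)
    (ε : ℕ → ℝ) (hε : ∀ N : ℕ, ε N = (ℓ * N) ^ (-(1 : ℝ) / (d - 1)))
    (f0N : ℕ → PhasePoint d → ℝ)
    (hmeas : ∀ N, Measurable (f0N N)) (hpos : ∀ N p, 0 ≤ f0N N p)
    (hint : ∀ N, (∫ p, f0N N p) = 1)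
    (C₀ β₀ : ℝ) (hC₀ : 0 < C₀) (hβ₀ : 0 < β₀)
    (hbound : ∀ N p, f0N N p ≤ C₀ * Real.exp (-(β₀ / 2) * (‖p.1‖ ^ 2 + ‖p.2‖ ^ 2)))
    (hZpos : ∀ N : ℕ, 0 < normConst d N (ε N) (f0N N)) :
    ∀ s : ℕ, 1 ≤ s → ∀ δ : ℝ, 0 < δ → ∃ N₀ : ℕ, ∀ N ≥ N₀,
      ∀ Zs ∈ hardSpherePhaseSpace d s (ε N),
        |marginal d N s
            (fun Z => (normConst d N (ε N) (f0N N))⁻¹ *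
              Set.indicator (hardSpherePhaseSpace d N (ε N)) (tensorPow d N (f0N N)) Z)
            Zs
          - tensorPow d s (f0N N) Zs| ≤ δ := by
  intro s hs δ hδ
  obtain ⟨K, hK, hball⟩ := ball_bound (d := d) C₀ β₀ hβ₀ hC₀
  have hlim : Filter.Tendsto (fun N : ℕ => K * ((N : ℝ) * (ε N) ^ d)) Filter.atTop (nhds 0) := by
    have := (lim_scaling d hd ℓ hℓ).const_mul K
    simpa only [hε, mul_zero] using this
  have hlim2 : Filter.Tendsto (fun t : ℝ => C₀ ^ s * (((1 - t) ^ s)⁻¹ - 1 + s * t / (1 - t)))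
      (nhds 0) (nhds 0) := by
    have : ContinuousAt (fun t : ℝ => C₀ ^ s * (((1 - t) ^ s)⁻¹ - 1 + s * t / (1 - t))) 0 := by
      refine ContinuousAt.mul continuousAt_const (ContinuousAt.add (ContinuousAt.sub
        (ContinuousAt.inv₀ (by fun_prop) (by simp)) continuousAt_const)
        (ContinuousAt.div (by fun_prop) (by fun_prop) (by simp)))
    simpa [ContinuousAt] using this
  have hev := (hlim2.comp hlim).eventually (ge_mem_nhds hδ)
  have hev2 := hlim.eventually (gt_mem_nhds (show (0 : ℝ) < 1 by norm_num))
  obtain ⟨N₀, hN₀⟩ := Filter.eventually_atTop.1 (hev.and hev2)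
  refine ⟨max N₀ (s + 1), fun N hN Zs hZs => ?_⟩
  obtain ⟨hfin, ht1⟩ := hN₀ N (le_of_max_le_left hN)
  have hNs : s + 1 ≤ N := le_of_max_le_right hN
  have hεn : 0 ≤ ε N := by rw [hε]; positivity
  set g := f0N N with hg
  have := dens_prob (hpos N) (hint N)
  set A : ENNReal := ENNReal.ofReal (K * ε N ^ d) with hA
  have hAb := hball g (hbound N) (ε N) hεn
  set M : ℕ → ℝ := fun k => (Measure.pi (fun _ : Fin k => dens d g)).real
    (hardSpherePhaseSpace d k (ε N)) with hM
  have hnorm : normConst d N (ε N) g = M N :=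
    integral_ind (hmeas N) (hpos N) (hint N) N (meas_hs d N (ε N))
  have hMN : 0 < M N := hnorm ▸ hZpos N
  rw [marginal_eq (hmeas N) (hpos N) (hint N) _ _ N s (by omega) Zs hZs, hnorm]
  set a : ℝ := K * ε N ^ d with ha
  have ha0 : 0 ≤ a := by positivity
  have hmono : ∀ k, M (k+1) ≤ M k := fun k =>
    ENNReal.toReal_mono (measure_ne_top _ _) (step_mono (dens d g) (ε N) k)
  have hanti : Antitone M := antitone_nat_of_succ_le hmono
  have hlow : ∀ k, M k ≤ M (k+1) + k * (a * M k) := by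
    intro k
    have h := ENNReal.toReal_mono (by finiteness) (step_lower (dens d g) (ε N) hAb k)
    rw [ENNReal.toReal_add (by finiteness) (by finiteness), ENNReal.toReal_mul, ENNReal.toReal_mul,
      ENNReal.toReal_ofReal ha0, ENNReal.toReal_natCast] at h
    exact h
  set t : ℝ := K * ((N : ℝ) * ε N ^ d) with ht
  have hta : t = N * a := by rw [ht, ha]; ring
  have hM0 : ∀ k, 0 ≤ M k := fun k => ENNReal.toReal_nonneg
  have ht0 : 0 ≤ t := by rw [hta]; positivity
  have hlow' : ∀ k, k ≤ N → (1 - t) * M k ≤ M (k+1) := by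
    intro k hk
    have h1 := hlow k
    have h2 : (k : ℝ) * (a * M k) ≤ N * (a * M k) :=
      mul_le_mul_of_nonneg_right (by exact_mod_cast hk) (mul_nonneg ha0 (hM0 k))
    rw [hta]
    linarith
  have hpow : ∀ r, r ≤ s → (1 - t) ^ r * M (N - s) ≤ M (N - s + r) := by
    intro r
    induction r with
    | zero => simp
    | succ r ih =>
      intro hr
      calc _ = (1 - t) * ((1 - t) ^ r * M (N - s)) := by ring
        _ ≤ (1 - t) * M (N - s + r) := mul_le_mul_of_nonneg_left (ih (by omega)) (by linarith)
        _ ≤ _ := hlow' _ (by omega)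
  have hup : (1 - t) ^ s * M (N - s) ≤ M N := by
    have := hpow s le_rfl
    rwa [Nat.sub_add_cancel (by omega)] at this
  set I : ℝ := (Measure.pi (fun _ : Fin (N - s) => dens d g)).real (crossSet (ε N) s (N - s) Zs)
    with hI
  have hI1 : I ≤ M (N - s) :=
    measureReal_mono Set.inter_subset_left
  obtain ⟨k, hk⟩ : ∃ k, N - s = k + 1 := ⟨N - s - 1, by omega⟩
  have hI2 : M (N - s) ≤ I + s * (t * M (N - s - 1)) := by
    have hc : ∀ m, m = k + 1 → M m ≤ (Measure.pi (fun _ : Fin m => dens d g)).real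
        (crossSet (ε N) s m Zs) + s * ((k + 1 : ℕ) * (a * M k)) := by
      rintro m rfl
      have h := ENNReal.toReal_mono (by finiteness) (step_cross (dens d g) (ε N) hAb s k Zs)
      rw [ENNReal.toReal_add (by finiteness) (by finiteness), ENNReal.toReal_mul,
        ENNReal.toReal_mul, ENNReal.toReal_mul,
        ENNReal.toReal_ofReal ha0, ENNReal.toReal_natCast, ENNReal.toReal_natCast] at h
      exact h
    have h1 := hc _ hk
    have h2 : N - s - 1 = k := by omega
    rw [h2]
    have h3 : ((k + 1 : ℕ) : ℝ) * (a * M k) ≤ N * (a * M k) :=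
      mul_le_mul_of_nonneg_right (by exact_mod_cast (by omega)) (mul_nonneg ha0 (hM0 k))
    have h4 : (s : ℝ) * (((k + 1 : ℕ) : ℝ) * (a * M k)) ≤ s * (N * (a * M k)) :=
      mul_le_mul_of_nonneg_left h3 (Nat.cast_nonneg s)
    rw [hta, mul_assoc (N : ℝ)]
    linarith
  have hprev : (1 - t) * M (N - s - 1) ≤ M (N - s) := by
    have := hlow' (N - s - 1) (by omega)
    rwa [show N - s - 1 + 1 = N - s by omega] at this
  have h1t : 0 < 1 - t := by linarith
  have hMNs : 0 < M (N - s) := hMN.trans_le (hanti (by omega))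
  have hT0 : 0 ≤ tensorPow d s g Zs := Finset.prod_nonneg fun i _ => hpos N _
  have hT1 : tensorPow d s g Zs ≤ C₀ ^ s := by
    calc tensorPow d s g Zs ≤ ∏ i : Fin s, C₀ := by
          refine Finset.prod_le_prod (fun i _ => hpos N _) fun i _ => (hbound N _).trans ?_
          refine mul_le_of_le_one_right hC₀.le (Real.exp_le_one_iff.2 ?_)
          have : 0 ≤ (β₀ / 2) * (‖(Zs i).1‖ ^ 2 + ‖(Zs i).2‖ ^ 2) := by positivity
          linarith
      _ = _ := by simp
  -- ratio bounds
  have hr1 : I / M N ≤ ((1 - t) ^ s)⁻¹ := by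
    rw [div_le_iff₀ hMN, inv_mul_eq_div, le_div_iff₀ (by positivity)]
    calc I * (1 - t) ^ s ≤ M (N - s) * (1 - t) ^ s := by gcongr
      _ ≤ M N := by linarith
  have hr2 : 1 - s * t / (1 - t) ≤ I / M N := by
    have hb : M (N - s - 1) ≤ M (N - s) / (1 - t) := by
      rw [le_div_iff₀ h1t]; linarith
    have hst : 0 ≤ (s : ℝ) * t := by positivity
    have h5 : (1 - s * t / (1 - t)) * M (N - s) ≤ I := by
      have := mul_le_mul_of_nonneg_left hb hst
      have h6 : s * t / (1 - t) * M (N - s) = s * t * (M (N - s) / (1 - t)) := by ring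
      nlinarith
    have h7 : I / M (N - s) ≤ I / M N :=
      div_le_div_of_nonneg_left ENNReal.toReal_nonneg hMN (hanti (by omega))
    exact ((le_div_iff₀ hMNs).2 h5).trans h7
  have hq1 : 0 ≤ (s : ℝ) * t / (1 - t) := by positivity
  have hq2 : 1 ≤ ((1 - t) ^ s)⁻¹ :=
    (one_le_inv₀ (by positivity)).2 (pow_le_one₀ h1t.le (by linarith))
  have heq : (M N)⁻¹ * (tensorPow d s g Zs * I) - tensorPow d s g Zs
      = tensorPow d s g Zs * (I / M N - 1) := by ring
  rw [heq, abs_mul, abs_of_nonneg hT0]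
  refine le_trans ?_ hfin
  refine mul_le_mul hT1 ?_ (abs_nonneg _) (by positivity)
  rw [abs_le]
  constructor <;> linarith

end
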